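/- Let G=(V,E) be a finite multigraph with a partition {B,R} of V, d≥3 an integer, D=binom(d+1,2), and f the count function f(F)=D(|V(F)|−1)−|R(F)|. Then for every F⊆E, f̂(F) = r_f(f∘F), where r_f(f∘F) is the rank of the set f∘F of copied edges in the count matroid M_f(f∘G) (defined on f∘G with the partition {B,R} of its vertex set V). That is, the rank of F in the polymatroid PM_f(G,{B,R}) equals the rank of f∘F in M_f(f∘G,{B,R}). -/

import Mathlib

/- STATEMENT 12: the rank of `F` in the polymatroid `PM_f(G,{B,R})` equals the rank of
`f∘F` in the count matroid `M_f(f∘G,{B,R})`. -/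

set_option synthInstance.maxHeartbeats 1000000
set_option maxHeartbeats 1000000

open scoped Classical

noncomputable section

/-- The set `V(F)` of vertices spanned by an edge set `F` in a multigraph whose edges `e : ε`
have endpoint pairs `π e : Sym2 V`. -/
def VF {V ε : Type} [Fintype V] (π : ε → Sym2 V) (F : Finset ε) : Finset V :=
  Finset.univ.filter (fun v => ∃ e ∈ F, v ∈ π e)

/-- The count function `f(F) = D·|V(F)| − D − |R(F)|`. -/
def fCnt {V ε : Type} [Fintype V] (D : ℕ) (π : ε → Sym2 V) (R : Finset V)
    (F : Finset ε) : ℤ :=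
  (D : ℤ) * (VF π F).card - D - ((VF π F) ∩ R).card

/-- Independence in the count matroid `M_f`: `|F'| ≤ f(F')` for all nonempty `F' ⊆ F`. -/
def CIndep {V ε : Type} [Fintype V] (D : ℕ) (π : ε → Sym2 V) (R : Finset V)
    (F : Finset ε) : Prop :=
  ∀ F' ⊆ F, F'.Nonempty → (F'.card : ℤ) ≤ fCnt D π R F'

/-- The rank function of the count matroid `M_f`: the maximum size of an independent subset. -/
def cRank {V ε : Type} [Fintype V] (D : ℕ) (π : ε → Sym2 V) (R : Finset V)
    (F : Finset ε) : ℕ :=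
  sSup {n : ℕ | ∃ F' ⊆ F, CIndep D π R F' ∧ F'.card = n}

/-- A circuit of the count matroid: a minimal dependent set. -/
def CCircuit {V ε : Type} [Fintype V] (D : ℕ) (π : ε → Sym2 V) (R : Finset V)
    (C : Finset ε) : Prop :=
  ¬ CIndep D π R C ∧ ∀ C' ⊂ C, CIndep D π R C'

/-- `F` is M-connected: every pair of its elements lies on a common circuit contained in `F`
(singletons and the empty set count as M-connected). -/
def MConn {V ε : Type} [Fintype V] (D : ℕ) (π : ε → Sym2 V) (R : Finset V)
    (F : Finset ε) : Prop :=
  F.card ≤ 1 ∨ ∀ e ∈ F, ∀ e' ∈ F, ∃ C ⊆ F, CCircuit D π R C ∧ e ∈ C ∧ e' ∈ C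

/-- `X` is an M-connected component of the count matroid restricted to the ground set `G`:
a maximal M-connected subset of `G`. -/
def MConnComp {V ε : Type} [Fintype V] (D : ℕ) (π : ε → Sym2 V) (R : Finset V)
    (G X : Finset ε) : Prop :=
  X ⊆ G ∧ MConn D π R X ∧ ∀ Y ⊆ G, MConn D π R Y → X ⊆ Y → Y = X

/-- `P` is a partition of `F` into nonempty parts. -/
def IsPartitionOf {ε : Type} [DecidableEq ε] (F : Finset ε) (P : Finset (Finset ε)) : Prop :=
  (∀ p ∈ P, p.Nonempty) ∧ (P : Set (Finset ε)).PairwiseDisjoint id ∧ P.biUnion id = F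

/-- The induced polymatroid function `f̂(F) = min Σᵢ f(Fᵢ)` over partitions of `F` into
nonempty parts (with `f̂(∅) = 0`). -/
def fHat {V ε : Type} [Fintype V] [DecidableEq ε] (D : ℕ) (π : ε → Sym2 V) (R : Finset V)
    (F : Finset ε) : ℤ :=
  sInf {s : ℤ | ∃ P : Finset (Finset ε), IsPartitionOf F P ∧ s = ∑ p ∈ P, fCnt D π R p}

/-- `F` is P-connected in the polymatroid `(E, f̂)`: no partition of `F` into at least two
nonempty parts satisfies `f̂(F) = Σᵢ f̂(Fᵢ)`. -/
def PConn {V ε : Type} [Fintype V] [DecidableEq ε] (D : ℕ) (π : ε → Sym2 V) (R : Finset V)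
    (F : Finset ε) : Prop :=
  F.Nonempty ∧ ∀ P : Finset (Finset ε), IsPartitionOf F P → 2 ≤ P.card →
    fHat D π R F ≠ ∑ p ∈ P, fHat D π R p

/-- `C` is a P-connected component of the polymatroid on the ground set `G`: a maximal
P-connected subset of `G`. -/
def PConnComp {V ε : Type} [Fintype V] [DecidableEq ε] (D : ℕ) (π : ε → Sym2 V) (R : Finset V)
    (G C : Finset ε) : Prop :=
  C ⊆ G ∧ PConn D π R C ∧ ∀ C' ⊆ G, PConn D π R C' → C ⊆ C' → C' = C

/-- The multiplicity `f({e}) = D − |R({e})|` of an edge in `f∘G`. -/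
def fMult {V ε : Type} [Fintype V] (D : ℕ) (π : ε → Sym2 V) (R : Finset V) (e : ε) : ℕ :=
  D - ((VF π ({e} : Finset ε)) ∩ R).card

/-- The set `f∘F` of all copies of edges of `F` in `f∘G`; copies of `e` are indexed by
`i : Fin D` with `i < f({e})`. -/
def fCopy {V ε : Type} [Fintype V] [DecidableEq ε] (D : ℕ) (π : ε → Sym2 V) (R : Finset V)
    (F : Finset ε) : Finset (ε × Fin D) :=
  F.biUnion (fun e =>
    ({e} : Finset ε) ×ˢ (Finset.univ.filter (fun i : Fin D => (i : ℕ) < fMult D π R e)))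

end

section helpers

noncomputable def gW {V : Type} (D : ℕ) (R : Finset V) (S : Finset V) : ℤ :=
  ∑ v ∈ S, ((D : ℤ) - if v ∈ R then 1 else 0)

theorem fCnt_eq {V ε : Type} [Fintype V] (D : ℕ) (π : ε → Sym2 V) (R : Finset V)
    (F : Finset ε) : fCnt D π R F = gW D R (VF π F) - D := by
  unfold fCnt gW
  rw [Finset.sum_sub_distrib, Finset.sum_const, Finset.sum_boole, Finset.filter_mem_eq_inter]
  simp only [nsmul_eq_mul]
  ring

theorem gW_mono {V : Type} {D : ℕ} (hD : 2 ≤ D) (R : Finset V) {S T : Finset V} (h : S ⊆ T) :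
    gW D R S ≤ gW D R T := by
  unfold gW
  apply Finset.sum_le_sum_of_subset_of_nonneg h
  intro i _ _
  split_ifs <;> omega

theorem gW_eq {V : Type} {D : ℕ} (hD : 2 ≤ D) (R : Finset V) {S T : Finset V} (h : S ⊆ T)
    (h' : gW D R T ≤ gW D R S) : S = T := by
  by_contra hne
  obtain ⟨v, hv, hvS⟩ := Finset.exists_of_ssubset (h.ssubset_of_ne hne)
  have : gW D R (insert v S) ≤ gW D R T :=
    gW_mono hD R (Finset.insert_subset hv h)
  have h2 : gW D R (insert v S) = ((D : ℤ) - if v ∈ R then 1 else 0) + gW D R S := by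
    unfold gW; rw [Finset.sum_insert hvS]
  split_ifs at h2 <;> omega

theorem VF_mono {V ε : Type} [Fintype V] (π : ε → Sym2 V) {A B : Finset ε} (h : A ⊆ B) :
    VF π A ⊆ VF π B := by
  intro v
  simp only [VF, Finset.mem_filter, Finset.mem_univ, true_and]
  rintro ⟨e, he, hv⟩
  exact ⟨e, h he, hv⟩

theorem fCnt_mono {V ε ε' : Type} [Fintype V] {D : ℕ} (hD : 2 ≤ D) (π : ε → Sym2 V)
    (π' : ε' → Sym2 V) (R : Finset V) {A : Finset ε} {B : Finset ε'} (h : VF π A ⊆ VF π' B) :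
    fCnt D π R A ≤ fCnt D π' R B := by
  rw [fCnt_eq, fCnt_eq]
  have := gW_mono hD R h
  omega

theorem fCnt_submod {V ε : Type} [Fintype V] [DecidableEq ε] {D : ℕ} (hD : 2 ≤ D)
    (π : ε → Sym2 V) (R : Finset V) (A B : Finset ε) :
    fCnt D π R (A ∪ B) + fCnt D π R (A ∩ B) ≤ fCnt D π R A + fCnt D π R B := by
  simp only [fCnt_eq]
  have h1 : VF π (A ∪ B) = VF π A ∪ VF π B := by
    ext v
    simp only [VF, Finset.mem_filter, Finset.mem_univ, true_and, Finset.mem_union]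
    constructor
    · rintro ⟨e, he | he, hv⟩
      · exact Or.inl ⟨e, he, hv⟩
      · exact Or.inr ⟨e, he, hv⟩
    · rintro (⟨e, he, hv⟩ | ⟨e, he, hv⟩)
      · exact ⟨e, Or.inl he, hv⟩
      · exact ⟨e, Or.inr he, hv⟩
  have h2 : VF π (A ∩ B) ⊆ VF π A ∩ VF π B :=
    Finset.subset_inter (VF_mono π Finset.inter_subset_left) (VF_mono π Finset.inter_subset_right)
  have h3 := gW_mono hD R h2
  have h4 : gW D R (VF π A ∪ VF π B) + gW D R (VF π A ∩ VF π B)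
      = gW D R (VF π A) + gW D R (VF π B) := by
    unfold gW; exact Finset.sum_union_inter
  rw [h1]
  omega

theorem tight_union {V ε : Type} [Fintype V] [DecidableEq ε] {D : ℕ} (hD : 2 ≤ D)
    (π : ε → Sym2 V) (R : Finset V) {I A B : Finset ε} (hI : CIndep D π R I)
    (hA : A ⊆ I) (hB : B ⊆ I) (hne : (A ∩ B).Nonempty)
    (tA : (A.card : ℤ) = fCnt D π R A) (tB : (B.card : ℤ) = fCnt D π R B) :
    ((A ∪ B).card : ℤ) = fCnt D π R (A ∪ B) := by
  have h1 := fCnt_submod hD π R A B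
  have h2 := hI (A ∩ B) (Finset.inter_subset_left.trans hA) hne
  have h3 := hI (A ∪ B) (Finset.union_subset hA hB)
    (hne.mono (Finset.inter_subset_left.trans Finset.subset_union_left))
  have h4 := Finset.card_union_add_card_inter A B
  omega

theorem fCnt_single {V ε : Type} [Fintype V] {D : ℕ} (hD : 3 ≤ D)
    (π : ε → Sym2 V) (R : Finset V) (e : ε) (he : ¬ (π e).IsDiag) :
    fCnt D π R {e} = fMult D π R e ∧ 1 ≤ fCnt D π R {e} := by
  have h2 : (VF π {e}).card = 2 := by
    rcases h : π e with ⟨a, b⟩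
    have hab : a ≠ b := by
      intro hab; apply he; rw [h]; exact hab
    have : VF π {e} = {a, b} := by
      ext v
      simp only [VF, Finset.mem_filter, Finset.mem_univ, true_and, Finset.mem_singleton,
        exists_eq_left, h, Finset.mem_insert]
      exact Sym2.mem_iff
    rw [this, Finset.card_pair hab]
  have h3 : (VF π {e} ∩ R).card ≤ (VF π {e}).card :=
    Finset.card_le_card Finset.inter_subset_left
  unfold fMult fCnt
  rw [h2] at h3 ⊢
  push_cast
  constructor <;> omega

theorem fCnt_nonneg {V ε : Type} [Fintype V] {D : ℕ} (hD : 3 ≤ D)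
    (π : ε → Sym2 V) (R : Finset V) (hπ : ∀ e, ¬ (π e).IsDiag) {A : Finset ε} (hA : A.Nonempty) :
    1 ≤ fCnt D π R A := by
  obtain ⟨e, he⟩ := hA
  refine (fCnt_single hD π R e (hπ e)).2.trans (fCnt_mono (by omega) π π R (VF_mono π ?_))
  simpa using he

theorem weak {V E : Type} [Fintype V] [DecidableEq E] {D : ℕ} (hD : 3 ≤ D)
    (π : E → Sym2 V) (R : Finset V) (hπ : ∀ e, ¬ (π e).IsDiag) (F : Finset E)
    (I : Finset (E × Fin D)) (hI : CIndep D (fun x : E × Fin D => π x.1) R I)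
    (hIF : ∀ x ∈ I, x.1 ∈ F) (P : Finset (Finset E)) (hP : IsPartitionOf F P) :
    (I.card : ℤ) ≤ ∑ p ∈ P, fCnt D π R p := by
  obtain ⟨h1, h2, h3⟩ := hP
  have hsub : I ⊆ P.biUnion (fun p => I.filter (fun x => x.1 ∈ p)) := by
    intro x hx
    have := hIF x hx
    rw [← h3] at this
    simp only [Finset.mem_biUnion, id] at this
    obtain ⟨p, hp, hxp⟩ := this
    simp only [Finset.mem_biUnion, Finset.mem_filter]
    exact ⟨p, hp, hx, hxp⟩
  have hc : (I.card : ℤ) ≤ ∑ p ∈ P, ((I.filter (fun x => x.1 ∈ p)).card : ℤ) := by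
    exact_mod_cast (Finset.card_le_card hsub).trans Finset.card_biUnion_le
  refine hc.trans (Finset.sum_le_sum ?_)
  intro p hp
  rcases (I.filter (fun x => x.1 ∈ p)).eq_empty_or_nonempty with h | h
  · rw [h]
    have := fCnt_nonneg hD π R hπ (h1 p hp)
    simp only [Finset.card_empty]
    push_cast
    omega
  · refine (hI _ (Finset.filter_subset _ _) h).trans (fCnt_mono (by omega) _ _ R ?_)
    intro v
    simp only [VF, Finset.mem_filter, Finset.mem_univ, true_and]
    rintro ⟨x, ⟨_, hx⟩, hv⟩
    exact ⟨x.1, hx, hv⟩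

theorem mem_fCopy {V E : Type} [Fintype V] [DecidableEq E] {D : ℕ}
    (π : E → Sym2 V) (R : Finset V) (F : Finset E) (x : E × Fin D) :
    x ∈ fCopy D π R F ↔ x.1 ∈ F ∧ (x.2 : ℕ) < fMult D π R x.1 := by
  unfold fCopy
  simp only [Finset.mem_biUnion, Finset.mem_product, Finset.mem_singleton, Finset.mem_filter,
    Finset.mem_univ, true_and]
  constructor
  · rintro ⟨e, he, rfl, h⟩; exact ⟨he, h⟩
  · rintro ⟨he, h⟩; exact ⟨_, he, rfl, h⟩

theorem exists_tight {V E : Type} [Fintype V] [DecidableEq E] {D : ℕ} (hD : 3 ≤ D)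
    (π : E → Sym2 V) (R : Finset V) (hπ : ∀ e, ¬ (π e).IsDiag) (F : Finset E)
    (I : Finset (E × Fin D)) (hI : CIndep D (fun x : E × Fin D => π x.1) R I)
    (hmax : ∀ x ∈ fCopy D π R F, x ∉ I →
      ¬ CIndep D (fun x : E × Fin D => π x.1) R (insert x I)) (e : E) (he : e ∈ F) :
    ∃ T ⊆ I, T.Nonempty ∧ (T.card : ℤ) = fCnt D (fun x : E × Fin D => π x.1) R T ∧
      VF π {e} ⊆ VF (fun x : E × Fin D => π x.1) T := by
  obtain ⟨hs1, hs2⟩ := fCnt_single hD π R e (hπ e)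
  by_cases hall : ∀ x ∈ fCopy D π R {e}, x ∈ I
  · have hcard : (fCopy D π R {e}).card = fMult D π R e := by
      unfold fCopy
      rw [Finset.singleton_biUnion, Finset.card_product, Finset.card_singleton, one_mul]
      rw [Fin.card_filter_val_lt]
      unfold fMult; omega
    have hne : (fCopy D π R {e}).Nonempty := by
      rw [← Finset.card_pos, hcard]; omega
    have hV : VF (fun x : E × Fin D => π x.1) (fCopy D π R {e}) = VF π {e} := by
      ext v
      simp only [VF, Finset.mem_filter, Finset.mem_univ, true_and]
      constructor
      · rintro ⟨x, hx, hv⟩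
        exact ⟨x.1, ((mem_fCopy π R _ x).1 hx).1, hv⟩
      · rintro ⟨a, ha, hv⟩
        obtain ⟨x, hx⟩ := hne
        refine ⟨x, hx, ?_⟩
        have := ((mem_fCopy π R _ x).1 hx).1
        rw [Finset.mem_singleton] at this ha
        rw [this, ← ha]; exact hv
    refine ⟨_, hall, hne, ?_, hV.ge⟩
    rw [hcard, ← hs1, fCnt_eq, fCnt_eq, hV]
  · push Not at hall
    obtain ⟨x, hx, hxI⟩ := hall
    obtain ⟨hx1, hx2⟩ := (mem_fCopy π R _ x).1 hx
    rw [Finset.mem_singleton] at hx1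
    have hd := hmax x ((mem_fCopy π R _ x).2 ⟨hx1 ▸ he, hx2⟩) hxI
    unfold CIndep at hd
    push Not at hd
    obtain ⟨S, hS, hSne, hlt⟩ := hd
    have hxS : x ∈ S := by
      by_contra hxS
      have := hI S ((Finset.subset_insert_iff_of_notMem hxS).1 hS) hSne
      omega
    have hTI : S.erase x ⊆ I := Finset.subset_insert_iff.1 hS
    have hcd := Finset.card_erase_add_one hxS
    have hpos := fCnt_nonneg hD (fun x : E × Fin D => π x.1) R (fun y => hπ y.1) hSne
    have hTne : (S.erase x).Nonempty := by
      rw [← Finset.card_pos]; omega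
    have h1 := hI _ hTI hTne
    have hVs := VF_mono (fun x : E × Fin D => π x.1) (Finset.erase_subset x S)
    have h2 := fCnt_mono (by omega : 2 ≤ D) _ _ R hVs
    have hVe : VF (fun x : E × Fin D => π x.1) (S.erase x) = VF (fun x : E × Fin D => π x.1) S := by
      apply gW_eq (by omega : 2 ≤ D) R hVs
      rw [fCnt_eq, fCnt_eq] at *
      omega
    refine ⟨_, hTI, hTne, by omega, ?_⟩
    rw [hVe]
    intro v
    simp only [VF, Finset.mem_filter, Finset.mem_univ, true_and, Finset.mem_singleton]
    rintro ⟨a, rfl, hv⟩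
    exact ⟨x, hxS, hx1 ▸ hv⟩

theorem strong {V E : Type} [Fintype V] [DecidableEq E] {D : ℕ} (hD : 3 ≤ D)
    (π : E → Sym2 V) (R : Finset V) (hπ : ∀ e, ¬ (π e).IsDiag) (F : Finset E)
    (I : Finset (E × Fin D)) (hI : CIndep D (fun x : E × Fin D => π x.1) R I)
    (hmax : ∀ x ∈ fCopy D π R F, x ∉ I →
      ¬ CIndep D (fun x : E × Fin D => π x.1) R (insert x I)) :
    ∃ P, IsPartitionOf F P ∧ ∑ p ∈ P, fCnt D π R p ≤ (I.card : ℤ) := by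
  have key : ∀ e : E, ∃ T : Finset (E × Fin D), e ∈ F → (T ⊆ I ∧ T.Nonempty ∧
      (T.card : ℤ) = fCnt D (fun x : E × Fin D => π x.1) R T ∧
      VF π {e} ⊆ VF (fun x : E × Fin D => π x.1) T) ∧
      ∀ A ⊆ I, A.Nonempty → (A.card : ℤ) = fCnt D (fun x : E × Fin D => π x.1) R A →
        (T ∩ A).Nonempty → A ⊆ T := by
    intro e
    by_cases he : e ∈ F
    · obtain ⟨T0, h0⟩ := exists_tight hD π R hπ F I hI hmax e he
      obtain ⟨T, hT, hTm⟩ := Finset.exists_max_image (I.powerset.filter (fun T => T.Nonempty ∧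
        (T.card : ℤ) = fCnt D (fun x : E × Fin D => π x.1) R T ∧
        VF π {e} ⊆ VF (fun x : E × Fin D => π x.1) T)) Finset.card
        ⟨T0, by simpa using h0⟩
      simp only [Finset.mem_filter, Finset.mem_powerset] at hT hTm
      refine ⟨T, fun _ => ⟨hT, ?_⟩⟩
      intro A hA hAne hAt hTA
      obtain ⟨t1, t2, t3, t4⟩ := hT
      have := hTm (T ∪ A) ⟨Finset.union_subset t1 hA, t2.mono Finset.subset_union_left,
        tight_union (by omega) _ R hI t1 hA hTA t3 hAt,
        t4.trans (VF_mono _ Finset.subset_union_left)⟩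
      have := Finset.eq_of_subset_of_card_le Finset.subset_union_left this
      rw [this]; exact Finset.subset_union_right
    · exact ⟨∅, fun h => absurd h he⟩
  choose T hT using key
  let fib : Finset (E × Fin D) → Finset E := fun t => F.filter (fun e => T e = t)
  have hfne : ∀ t ∈ F.image T, (fib t).Nonempty := by
    intro t ht
    obtain ⟨e, he, rfl⟩ := Finset.mem_image.1 ht
    exact ⟨e, Finset.mem_filter.2 ⟨he, rfl⟩⟩
  have hinj : Set.InjOn fib (F.image T : Finset _) := by
    intro s hs t _ hst
    obtain ⟨e, he⟩ := hfne s hs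
    have h1 := (Finset.mem_filter.1 he).2
    rw [hst] at he
    exact h1.symm.trans (Finset.mem_filter.1 he).2
  refine ⟨(F.image T).image fib, ⟨?_, ?_, ?_⟩, ?_⟩
  · intro p hp
    obtain ⟨t, ht, rfl⟩ := Finset.mem_image.1 hp
    exact hfne t ht
  · intro p hp q hq hpq
    obtain ⟨s, hs, rfl⟩ := Finset.mem_image.1 (Finset.mem_coe.1 hp)
    obtain ⟨t, ht, rfl⟩ := Finset.mem_image.1 (Finset.mem_coe.1 hq)
    refine Finset.disjoint_left.2 ?_
    intro e h1 h2
    apply hpq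
    have h3 := (Finset.mem_filter.1 h1).2
    have h4 := (Finset.mem_filter.1 h2).2
    rw [← h3, ← h4]
  · ext e
    simp only [Finset.mem_biUnion, Finset.mem_image, id]
    constructor
    · rintro ⟨p, ⟨t, _, rfl⟩, h⟩
      exact (Finset.mem_filter.1 h).1
    · intro he
      exact ⟨_, ⟨T e, ⟨e, he, rfl⟩, rfl⟩, Finset.mem_filter.2 ⟨he, rfl⟩⟩
  · rw [Finset.sum_image hinj]
    have hle : ∀ t ∈ F.image T, fCnt D π R (fib t) ≤ (t.card : ℤ) := by
      intro t ht
      obtain ⟨e, he, rfl⟩ := Finset.mem_image.1 ht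
      rw [(hT e he).1.2.2.1]
      apply fCnt_mono (by omega)
      intro v hv
      simp only [VF, Finset.mem_filter, Finset.mem_univ, true_and] at hv
      obtain ⟨a, ha, hv⟩ := hv
      obtain ⟨haF, haT⟩ := Finset.mem_filter.1 ha
      rw [← haT]
      apply (hT a haF).1.2.2.2
      simpa [VF] using hv
    refine (Finset.sum_le_sum hle).trans ?_
    have hdis : ((F.image T : Finset _) : Set (Finset (E × Fin D))).PairwiseDisjoint id := by
      intro s hs t ht hst
      obtain ⟨a, ha, rfl⟩ := Finset.mem_image.1 (Finset.mem_coe.1 hs)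
      obtain ⟨b, hb, rfl⟩ := Finset.mem_image.1 (Finset.mem_coe.1 ht)
      obtain ⟨⟨a1, a2, a3, a4⟩, a5⟩ := hT a ha
      obtain ⟨⟨b1, b2, b3, b4⟩, b5⟩ := hT b hb
      by_contra hnd
      have hne : (T a ∩ T b).Nonempty := by
        rw [Finset.nonempty_iff_ne_empty]
        intro h0
        exact hnd (Finset.disjoint_iff_inter_eq_empty.2 h0)
      exact hst (Finset.Subset.antisymm (b5 _ a1 a2 a3 (by rwa [Finset.inter_comm]))
        (a5 _ b1 b2 b3 hne))
    have hcb := Finset.card_biUnion hdis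
    have hsub : (F.image T).biUnion id ⊆ I := by
      intro x hx
      simp only [Finset.mem_biUnion, Finset.mem_image, id] at hx
      obtain ⟨t, ⟨e, he, rfl⟩, hx⟩ := hx
      exact (hT e he).1.1 hx
    have := Finset.card_le_card hsub
    rw [hcb] at this
    exact_mod_cast this

end helpers

theorem statement_12
    (V E : Type) [Fintype V] [Fintype E] [DecidableEq V] [DecidableEq E]
    (π : E → Sym2 V) (hπ : ∀ e : E, ¬ (π e).IsDiag)
    (B R : Finset V) (hdisj : Disjoint B R) (hcov : B ∪ R = Finset.univ)
    (d D : ℕ) (hd : 3 ≤ d) (hD : D = (d + 1).choose 2)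
    (F : Finset E) :
    fHat D π R F
      = (cRank D (fun x : E × Fin D => π x.1) R (fCopy D π R F) : ℤ) := by
  have hD3 : 3 ≤ D := by
    rw [hD]
    calc 3 ≤ (3 + 1).choose 2 := by decide
      _ ≤ (d + 1).choose 2 := Nat.choose_le_choose 2 (by omega)
  obtain ⟨I, hIm, hIx⟩ := Finset.exists_max_image
    ((fCopy D π R F).powerset.filter (CIndep D (fun x : E × Fin D => π x.1) R)) Finset.card
    ⟨∅, by
      simp only [Finset.mem_filter, Finset.mem_powerset, Finset.empty_subset, true_and]
      intro A hA hne
      rw [Finset.subset_empty.1 hA] at hne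
      exact absurd hne (by simp)⟩
  simp only [Finset.mem_filter, Finset.mem_powerset] at hIm hIx
  obtain ⟨hIF, hI⟩ := hIm
  have hrank : cRank D (fun x : E × Fin D => π x.1) R (fCopy D π R F) = I.card := by
    apply IsGreatest.csSup_eq
    refine ⟨⟨I, hIF, hI, rfl⟩, ?_⟩
    rintro n ⟨J, hJ, hJI, rfl⟩
    exact hIx J ⟨hJ, hJI⟩
  have hw := weak hD3 π R hπ F I hI (fun x hx => ((mem_fCopy π R F x).1 (hIF hx)).1)
  obtain ⟨P, hP, hle⟩ := strong hD3 π R hπ F I hI (by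
    intro x hx hxI hc
    have := hIx _ ⟨Finset.insert_subset hx hIF, hc⟩
    rw [Finset.card_insert_of_notMem hxI] at this
    omega)
  rw [hrank]
  apply IsLeast.csInf_eq
  refine ⟨⟨P, hP, le_antisymm (hw P hP) hle⟩, ?_⟩
  rintro s ⟨Q, hQ, rfl⟩
  exact hw Q hQ
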